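/- Let l, m, n be integers with 2 ≤ l, m, n < ∞, H a complex Hilbert space, and (u_1, …, u_l) a Cuntz family of order l on H. Let (r_1, …, r_m) be the induced Cuntz family of order m built from (u_1, …, u_l), and let (S_1, …, S_n) be the induced Cuntz family of order n built from (r_1, …, r_m). Then (S_1, …, S_n) equals the induced Cuntz family of order n built directly from (u_1, …, u_l). (This is the functor identity F_{n,m} ∘ F_{m,l} = F_{n,l} on the level of representations.) -/

import Mathlib

open Filter

noncomputable section

variable {H : Type*} [NormedAddCommGroup H] [InnerProductSpace ℂ H] [CompleteSpace H]

/-- A Cuntz family of order `n` on `H` (0-based indexing: `S 0, …, S (n-1)`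
correspond to the Cuntz generators `S_1, …, S_n` of `O_n`). -/
def CuntzFamily (n : ℕ) (S : ℕ → H →L[ℂ] H) : Prop :=
  (∀ i < n, ∀ j < n, ContinuousLinearMap.adjoint (S i) * S j = if i = j then 1 else 0) ∧
  ∑ i ∈ Finset.range n, S i * ContinuousLinearMap.adjoint (S i) = 1

/-- An `O_∞` family on `H` (0-based: `t 0, t 1, …` correspond to `t_1, t_2, …`). -/
def OInfFamily (t : ℕ → H →L[ℂ] H) : Prop :=
  ∀ i j, ContinuousLinearMap.adjoint (t i) * t j = if i = j then 1 else 0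

/-- `T` is the associated `O_∞` family of the order-`n` Cuntz family `S`:
`T_{(n-1)k+i} = S_n^k S_i`, i.e. (0-based) `T ((n-1)*k + i) = S (n-1) ^ k * S i`
for `k ≥ 0` and `i < n - 1`.  This corresponds to the embedding
`f_{n,∞} : O_∞ → O_n`, `f_{n,∞}(t_{(n-1)k+i}) = s_n^k s_i`. -/
def IsAssocOInf (n : ℕ) (S T : ℕ → H →L[ℂ] H) : Prop :=
  ∀ k i, i < n - 1 → T ((n - 1) * k + i) = S (n - 1) ^ k * S i

/-- `R` is the strong-operator-topology sum `R_a = ∑_{j≥1} t_{j+a} t_j*`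
(0-based indexing of the family). -/
def IsSOTSum (t : ℕ → H →L[ℂ] H) (a : ℕ) (R : H →L[ℂ] H) : Prop :=
  ∀ x : H,
    Tendsto (fun N => ∑ j ∈ Finset.range N, (t (j + a) * ContinuousLinearMap.adjoint (t j)) x)
      atTop (nhds (R x))

lemma assoc_low {n : ℕ} {S T : ℕ → H →L[ℂ] H} (h : IsAssocOInf n S T) {i : ℕ}
    (hi : i < n - 1) : T i = S i := by
  have := h 0 i hi
  simpa using this

lemma assoc_shift {n : ℕ} (hn : 2 ≤ n) {S T : ℕ → H →L[ℂ] H} (h : IsAssocOInf n S T) (j : ℕ) :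
    T (j + (n - 1)) = S (n - 1) * T j := by
  have hlt : j % (n - 1) < n - 1 := Nat.mod_lt _ (by omega)
  have e := Nat.div_add_mod j (n - 1)
  have h1 := h (j / (n - 1)) _ hlt
  have h2 := h (j / (n - 1) + 1) _ hlt
  rw [e] at h1
  have e2 : (n - 1) * (j / (n - 1) + 1) + j % (n - 1) = j + (n - 1) := by
    rw [mul_add, mul_one]; omega
  rw [e2] at h2
  rw [h1, h2, pow_succ', mul_assoc]

lemma assoc_oinf {n : ℕ} (hn : 2 ≤ n) {S T : ℕ → H →L[ℂ] H} (hS : CuntzFamily n S)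
    (h : IsAssocOInf n S T) : OInfFamily T := by
  have hshift := assoc_shift hn h
  have adj_mul : ∀ A B : H →L[ℂ] H, ContinuousLinearMap.adjoint (A * B) =
      ContinuousLinearMap.adjoint B * ContinuousLinearMap.adjoint A := fun A B =>
    ContinuousLinearMap.adjoint_comp A B
  intro i
  induction i using Nat.strong_induction_on with
  | _ i ih =>
    intro j
    by_cases hi : i < n - 1
    · by_cases hj : j < n - 1
      · rw [assoc_low h hi, assoc_low h hj]
        exact hS.1 i (by omega) j (by omega)
      · obtain ⟨j, rfl⟩ := Nat.exists_eq_add_of_le' (not_lt.1 hj)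
        rw [assoc_low h hi, hshift, ← mul_assoc, hS.1 i (by omega) (n - 1) (by omega),
          if_neg (by omega), if_neg (by omega), zero_mul]
    · obtain ⟨i, rfl⟩ := Nat.exists_eq_add_of_le' (not_lt.1 hi)
      rw [hshift, adj_mul, mul_assoc]
      by_cases hj : j < n - 1
      · rw [assoc_low h hj, hS.1 (n - 1) (by omega) j (by omega),
          if_neg (by omega), if_neg (by omega), mul_zero]
      · obtain ⟨j, rfl⟩ := Nat.exists_eq_add_of_le' (not_lt.1 hj)
        rw [hshift, ← mul_assoc (ContinuousLinearMap.adjoint (S (n - 1))),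
          hS.1 (n - 1) (by omega) (n - 1) (by omega), if_pos rfl, one_mul, ih i (by omega) j]
        simp

lemma sot_mul {T : ℕ → H →L[ℂ] H} (hT : OInfFamily T) {a : ℕ} {R : H →L[ℂ] H}
    (hR : IsSOTSum T a R) (j : ℕ) : R * T j = T (j + a) := by
  ext x
  refine tendsto_nhds_unique (hR (T j x)) ?_
  refine tendsto_const_nhds.congr' ?_
  filter_upwards [eventually_gt_atTop j] with N hN
  have key : ∀ k, (T (k + a) * ContinuousLinearMap.adjoint (T k)) (T j x) =
      if k = j then T (j + a) x else 0 := by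
    intro k
    have := congrArg (fun A : H →L[ℂ] H => T (k + a) (A x)) (hT k j)
    refine Eq.trans this ?_
    split_ifs with hk
    · subst hk; rfl
    · simp
  simp [key, hN]

lemma sot_mul_zero {T : ℕ → H →L[ℂ] H} (hT : OInfFamily T) {a : ℕ} {R Q : H →L[ℂ] H}
    (hR : IsSOTSum T a R) (hQ : IsSOTSum T 0 Q) : R * Q = R := by
  ext x
  have h1 := (R.continuous.tendsto _).comp (hQ x)
  refine tendsto_nhds_unique h1 ((hR x).congr fun N => ?_)
  simp only [Function.comp, map_sum]
  refine Finset.sum_congr rfl fun j _ => ?_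
  rw [← sot_mul hT hR j]
  rfl

theorem stmt14 (l m n : ℕ) (hl : 2 ≤ l) (hm : 2 ≤ m) (hn : 2 ≤ n)
    (u Tu Ru : ℕ → H →L[ℂ] H)
    (hu : CuntzFamily l u) (hTu : IsAssocOInf l u Tu) (hRu : ∀ a, IsSOTSum Tu a (Ru a))
    (r : ℕ → H →L[ℂ] H) (hr₁ : ∀ i < m - 1, r i = Tu i)
    (hr₂ : r (m - 1) = u (l - 1) * (1 - Ru 0) + Ru (m - 1))
    (Tr Rr : ℕ → H →L[ℂ] H)
    (hTr : IsAssocOInf m r Tr) (hRr : ∀ a, IsSOTSum Tr a (Rr a))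
    (S : ℕ → H →L[ℂ] H) (hS₁ : ∀ i < n - 1, S i = Tr i)
    (hS₂ : S (n - 1) = r (m - 1) * (1 - Rr 0) + Rr (n - 1))
    (S' : ℕ → H →L[ℂ] H) (hS'₁ : ∀ i < n - 1, S' i = Tu i)
    (hS'₂ : S' (n - 1) = u (l - 1) * (1 - Ru 0) + Ru (n - 1)) :
    ∀ i < n, S i = S' i := by
  have hO := assoc_oinf hl hu hTu
  have hrT : ∀ j, r (m - 1) * Tu j = Tu (j + (m - 1)) := by
    intro j
    have h0 : Ru 0 * Tu j = Tu j := sot_mul hO (hRu 0) j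
    rw [hr₂, add_mul, mul_assoc, sub_mul, one_mul, h0, sub_self, mul_zero, zero_add,
      sot_mul hO (hRu _) j]
  have hT : ∀ j, Tr j = Tu j := by
    intro j
    induction j using Nat.strong_induction_on with
    | _ j ih =>
      by_cases hj : j < m - 1
      · rw [assoc_low hTr hj, hr₁ j hj]
      · obtain ⟨j, rfl⟩ := Nat.exists_eq_add_of_le' (not_lt.1 hj)
        rw [assoc_shift hm hTr, ih j (by omega), hrT]
  have hTe : Tr = Tu := funext hT
  subst hTe
  have hRe : ∀ a, Rr a = Ru a := fun a => by
    ext x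
    exact tendsto_nhds_unique (hRr a x) (hRu a x)
  intro i hi
  by_cases h : i < n - 1
  · rw [hS₁ i h, hS'₁ i h]
  · obtain rfl : i = n - 1 := by omega
    have hz : ∀ a, Ru a * (1 - Ru 0) = 0 := fun a => by
      rw [mul_sub, mul_one, sot_mul_zero hO (hRu a) (hRu 0), sub_self]
    rw [hS₂, hS'₂, hRe, hRe, hr₂, add_mul, hz, add_zero, mul_assoc, sub_mul 1 (Ru 0), hz,
      one_mul, sub_zero]
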